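/- arXiv:math-ph/0409030 — 4 statements merged into one kernel-verified Lean document; each statement's English description precedes it below -/
import Mathlib

section
/- Let (X, 𝒜, λ) be a measure space, let G : X × X → [0,∞) be jointly measurable with ∫_X G(x, y) dλ(x) ≤ C for every y ∈ X, and let v : ℝ → ℝ be Borel measurable, concave on [0,∞), with |v(t)| ≤ b·t for all t ≥ 0, where b, C > 0. Then for every point x₀ ∈ X and every measurable Φ : X → [0,∞), the function x ↦ v(G(x, x₀) + Φ(x)) − v(Φ(x)) is λ-integrable and |∫_X [v(G(x, x₀) + Φ(x)) − v(Φ(x))] dλ(x)| ≤ b·C. (This is the stochastic upper bound (ii): the conditional energy W(x₀, η) + U(δ_{x₀}) is uniformly bounded by B = bC, so the Papangelou intensity is bounded by e^{βB}.) -/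
open MeasureTheory

/-- A concave function on `[0, ∞)` vanishing at the origin is subadditive there. -/
theorem ConcaveOn.map_add_le_of_map_zero {v : ℝ → ℝ}
    (hv : ConcaveOn ℝ (Set.Ici (0 : ℝ)) v) (h0 : v 0 = 0) {s t : ℝ} (hs : 0 ≤ s) (ht : 0 ≤ t) :
    v (s + t) ≤ v s + v t := by
  rcases hs.eq_or_lt with rfl | hs'
  · simp [h0]
  have hst : 0 < s + t := by linarith
  have hsum : s / (s + t) + t / (s + t) = 1 := by field_simp
  have hmem : s + t ∈ Set.Ici (0 : ℝ) := hst.le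
  have h0mem : (0 : ℝ) ∈ Set.Ici (0 : ℝ) := le_refl (0 : ℝ)
  have h1 := hv.2 hmem h0mem (div_nonneg hs hst.le) (div_nonneg ht hst.le) hsum
  have h2 := hv.2 h0mem hmem (div_nonneg hs hst.le) (div_nonneg ht hst.le) hsum
  simp only [smul_eq_mul, mul_zero, add_zero, zero_add, h0, div_mul_cancel₀ _ hst.ne'] at h1 h2
  calc v (s + t) = (s / (s + t) + t / (s + t)) * v (s + t) := by rw [hsum, one_mul]
    _ = s / (s + t) * v (s + t) + t / (s + t) * v (s + t) := add_mul _ _ _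
    _ ≤ v s + v t := add_le_add h1 h2

/-- A nonnegative concave function on `[0, ∞)` is monotone there. -/
theorem ConcaveOn.monotoneOn_Ici_of_nonneg {w : ℝ → ℝ}
    (hw : ConcaveOn ℝ (Set.Ici (0 : ℝ)) w) (hw0 : ∀ t, 0 ≤ t → 0 ≤ w t) :
    MonotoneOn w (Set.Ici 0) := by
  intro x hx y hy hxy
  by_contra! hlt
  have hx0 : 0 ≤ x := hx
  obtain ⟨n, hn⟩ := exists_nat_gt (w x / (w x - w y))
  have hd : 0 < w x - w y := sub_pos.2 hlt
  have hn0 : (0 : ℝ) < n := (div_nonneg (hw0 x hx0) hd.le).trans_lt hn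
  rw [div_lt_iff₀ hd] at hn
  have hn1 : (1 : ℝ) ≤ n := by
    exact_mod_cast Nat.one_le_iff_ne_zero.2 (by rintro rfl; simp at hn0)
  have hz : 0 ≤ x + n * (y - x) := by nlinarith
  have h := hw.2 hx (show x + n * (y - x) ∈ Set.Ici (0 : ℝ) from hz)
    (sub_nonneg.2 (inv_le_one_of_one_le₀ hn1)) (inv_nonneg.2 hn0.le) (by ring)
  have harg : (1 - (n : ℝ)⁻¹) * x + (n : ℝ)⁻¹ * (x + n * (y - x)) = y := by
    field_simp
    ring
  simp only [smul_eq_mul, harg] at h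
  have h2 : (1 - (n : ℝ)⁻¹) * w x ≤ w y :=
    le_trans (le_add_of_nonneg_right (mul_nonneg (inv_nonneg.2 hn0.le) (hw0 _ hz))) h
  have h3 := mul_le_mul_of_nonneg_left h2 hn0.le
  have h4 : (n : ℝ) * ((1 - (n : ℝ)⁻¹) * w x) = n * w x - w x := by
    field_simp
  linarith

/-- A concave function on `[0, ∞)` with `|v t| ≤ b t` has increments bounded by `b`. -/
theorem ConcaveOn.abs_map_add_sub_le {v : ℝ → ℝ} {b : ℝ}
    (hv : ConcaveOn ℝ (Set.Ici (0 : ℝ)) v) (hlin : ∀ t : ℝ, 0 ≤ t → |v t| ≤ b * t)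
    {s t : ℝ} (hs : 0 ≤ s) (ht : 0 ≤ t) : |v (s + t) - v t| ≤ b * s := by
  have h0 : v 0 = 0 := by simpa using hlin 0 le_rfl
  have hw : ConcaveOn ℝ (Set.Ici (0 : ℝ)) fun r => v r + b * r :=
    hv.add ((LinearMap.mulLeft ℝ b).concaveOn (convex_Ici 0))
  have hmono := hw.monotoneOn_Ici_of_nonneg fun r hr => by
    linarith [neg_le_of_abs_le (hlin r hr)]
  have h1 := hmono (show t ∈ Set.Ici (0 : ℝ) from ht)
    (show s + t ∈ Set.Ici (0 : ℝ) from add_nonneg hs ht) (le_add_of_nonneg_left hs)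
  have h2 := hv.map_add_le_of_map_zero h0 hs ht
  have h3 := le_of_abs_le (hlin s hs)
  dsimp only at h1
  exact abs_le.2 ⟨by linarith, by linarith⟩

/-- Stochastic upper bound for the weakly attractive interaction: the conditional
energy `W(x₀, η) + U(δ_{x₀}) = ∫ v(G(·,x₀) + Φ) - v(Φ) dλ` is uniformly bounded
by `b C`. -/
theorem conditional_energy_bound {X : Type*} [MeasurableSpace X] (lam : Measure X)
    (G : X → X → ℝ) (hGm : Measurable fun p : X × X => G p.1 p.2)
    (hG0 : ∀ x y, 0 ≤ G x y)
    (C b : ℝ) (hC : 0 < C) (hb : 0 < b)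
    (hGint : ∀ y, Integrable (fun x => G x y) lam)
    (hGC : ∀ y, ∫ x, G x y ∂lam ≤ C)
    (v : ℝ → ℝ) (hvm : Measurable v)
    (hv : ConcaveOn ℝ (Set.Ici (0 : ℝ)) v)
    (hlin : ∀ t : ℝ, 0 ≤ t → |v t| ≤ b * t)
    (x₀ : X) (Φ : X → ℝ) (hΦm : Measurable Φ) (hΦ0 : ∀ x, 0 ≤ Φ x) :
    Integrable (fun x => v (G x x₀ + Φ x) - v (Φ x)) lam ∧
    |∫ x, (v (G x x₀ + Φ x) - v (Φ x)) ∂lam| ≤ b * C := by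
  have hbound : ∀ x, ‖v (G x x₀ + Φ x) - v (Φ x)‖ ≤ b * G x x₀ := fun x =>
    hv.abs_map_add_sub_le hlin (hG0 x x₀) (hΦ0 x)
  have hG : Measurable fun x => G x x₀ := hGm.comp measurable_prodMk_right
  have hint : Integrable (fun x => b * G x x₀) lam := (hGint x₀).const_mul b
  refine ⟨hint.mono' (((hvm.comp (hG.add hΦm)).sub (hvm.comp hΦm)).aestronglyMeasurable)
    (ae_of_all _ hbound), ?_⟩
  calc |∫ x, (v (G x x₀ + Φ x) - v (Φ x)) ∂lam| ≤ ∫ x, b * G x x₀ ∂lam :=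
        norm_integral_le_of_norm_le hint (ae_of_all _ hbound)
    _ = b * ∫ x, G x x₀ ∂lam := integral_const_mul _ _
    _ ≤ b * C := mul_le_mul_of_nonneg_left (hGC x₀) hb.le
end

section
/- Let (S, 𝒮) be a measurable space and let G^c : ℂ^d × S → ℂ be such that: x ↦ G^c(z, x) is measurable for each z ∈ ℂ^d; z ↦ G^c(z, x) is holomorphic on ℂ^d for each x ∈ S; and for every compact K ⊆ ℂ^d the function g_K(x) = sup_{z∈K} |G^c(z, x)| is measurable. Let μ be a probability measure on the space of measures on S (equipped with the σ-algebra generated by the evaluation maps η ↦ η(A), A ∈ 𝒮), and assume that for every compact K ⊆ ℂ^d one has ∫ exp(∫_S g_K dη) dμ(η) < ∞ (with the convention exp(∞) = ∞). Then for every n ≥ 1 the analytically continued Schwinger function S_n^c(z₁, …, z_n) = ∫ (∏_{j=1}^n ∫_S G^c(z_j, x) dη(x)) dμ(η) is well-defined (the integrand being μ-integrable, with the inner integrals defined for the μ-almost every η for which ∫ g_K dη < ∞ for all compact K) and is holomorphic on (ℂ^d)ⁿ. (This is Theorem 6.2: the Schwinger functions are restrictions to the real points of holomorphic functions.) -/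
open MeasureTheory

/-- The compact envelope `g_K(x) = sup_{z ∈ K} |G(z, x)|` of a kernel. -/
noncomputable def envelope {d : ℕ} {S : Type*}
    (G : (Fin d → ℂ) → S → ℂ) (K : Set (Fin d → ℂ)) (x : S) : ℝ :=
  sSup ((fun z => ‖G z x‖) '' K)

/-- The exponential on `[0, ∞]` with the convention `exp(∞) = ∞`. -/
noncomputable def expE (a : ENNReal) : ENNReal :=
  if a = ⊤ then ⊤ else ENNReal.ofReal (Real.exp a.toReal)

open Filter Topology Metric

/-- A function with values in continuous linear forms on a finite-dimensional space is strongly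
measurable as soon as its evaluation at each vector is. -/
theorem aestronglyMeasurable_clm_of_apply {α E : Type*} [MeasurableSpace α] {ν : Measure α}
    [NormedAddCommGroup E] [NormedSpace ℂ E] [FiniteDimensional ℂ E] {L : α → E →L[ℂ] ℂ}
    (h : ∀ v, AEStronglyMeasurable (fun a => L a v) ν) : AEStronglyMeasurable L ν := by
  let b := Module.finBasis ℂ E
  have hL : L = fun a => ∑ i, L a (b i) • LinearMap.toContinuousLinearMap (b.coord i) := by
    funext a
    ext v
    conv_lhs => rw [← b.sum_repr v, map_sum]
    simp only [map_smul, smul_eq_mul]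
    simp [mul_comm]
  rw [hL]
  exact Finset.aestronglyMeasurable_fun_sum _ fun i _ => (h (b i)).smul_const _

/-- An integral depending holomorphically on a finite-dimensional parameter is holomorphic if its
integrand is locally dominated. -/
theorem differentiable_integral_of_locally_dominated {α E : Type*} [MeasurableSpace α]
    {ν : Measure α} [NormedAddCommGroup E] [NormedSpace ℂ E] [FiniteDimensional ℂ E]
    {F : E → α → ℂ} (hmeas : ∀ z, AEStronglyMeasurable (F z) ν)
    (hdiff : ∀ᵐ a ∂ν, Differentiable ℂ (fun z => F z a))
    (hdom : ∀ z₀, ∃ r > 0, ∃ g : α → ℝ, Integrable g ν ∧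
      ∀ᵐ a ∂ν, ∀ z ∈ ball z₀ r, ‖F z a‖ ≤ g a) :
    Differentiable ℂ (fun z => ∫ a, F z a ∂ν) := by
  intro z₀
  obtain ⟨r, hr, g, hg, hFg⟩ := hdom z₀
  refine (hasFDerivAt_integral_of_dominated_loc_of_lip' (s := ball z₀ r)
    (F' := fun a => fderiv ℂ (fun z => F z a) z₀) (bound := fun a => 2 * g a / r)
    (ball_mem_nhds z₀ hr) (fun z _ => hmeas z) ?_ ?_ ?_ ?_ ?_).2.differentiableAt
  · refine hg.mono' (hmeas z₀) ?_
    filter_upwards [hFg] with a ha using ha z₀ (mem_ball_self hr)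
  · refine aestronglyMeasurable_clm_of_apply fun v => ?_
    refine aestronglyMeasurable_of_tendsto_ae (u := atTop) (f := fun (k : ℕ) a =>
      (k : ℂ) • (F (z₀ + (k : ℂ)⁻¹ • v) a - F z₀ a))
      (fun k => ((hmeas _).fun_sub (hmeas _)).fun_const_smul _) ?_
    filter_upwards [hdiff] with a ha
    refine (ha z₀).hasFDerivAt.lim v ?_
    simpa using tendsto_natCast_atTop_atTop (R := ℝ)
  · filter_upwards [hdiff, hFg] with a ha hb z hz
    rw [← dist_eq_norm, ← dist_eq_norm]
    refine Complex.dist_le_div_mul_dist_of_mapsTo_ball ha.differentiableOn (fun w hw => ?_) hz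
    rw [mem_closedBall, dist_eq_norm]
    refine (norm_sub_le _ _).trans ?_
    linarith [hb w hw, hb z₀ (mem_ball_self hr)]
  · exact (hg.const_mul 2).div_const r
  · filter_upwards [hdiff] with a ha using (ha z₀).hasFDerivAt

/-- The integral of a measurable function against a random measure is almost everywhere measurable
when the function is almost surely integrable. -/
theorem aemeasurable_integral_random_measure {S : Type*} [MeasurableSpace S]
    {μ : Measure (Measure S)} {f : S → ℂ} (hf : Measurable f)
    (hint : ∀ᵐ η ∂μ, Integrable f η) : AEMeasurable (fun η : Measure S => ∫ x, f x ∂η) μ := by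
  have key (u : S → ℝ) (hu : Measurable u) : Measurable (fun η : Measure S =>
      ENNReal.toReal (∫⁻ a, .ofReal (u a) ∂η) - ENNReal.toReal (∫⁻ a, .ofReal (-u a) ∂η)) :=
    (Measure.measurable_lintegral hu.ennreal_ofReal).ennreal_toReal.sub
      (Measure.measurable_lintegral hu.neg.ennreal_ofReal).ennreal_toReal
  refine ⟨_, (Complex.measurable_ofReal.comp (key _ (Complex.measurable_re.comp hf))).add
    ((Complex.measurable_ofReal.comp (key _ (Complex.measurable_im.comp hf))).mul_const
      Complex.I), ?_⟩
  filter_upwards [hint] with η hη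
  have hre : Integrable (fun x => (f x).re) η := hη.re
  have him : Integrable (fun x => (f x).im) η := hη.im
  simp only [Pi.add_apply, Function.comp_def]
  rw [← integral_eq_lintegral_pos_part_sub_lintegral_neg_part hre,
    ← integral_eq_lintegral_pos_part_sub_lintegral_neg_part him]
  exact (integral_re_add_im hη).symm

theorem measurable_expE : Measurable expE :=
  Measurable.ite (measurableSet_singleton ⊤) measurable_const
    (Real.measurable_exp.comp ENNReal.measurable_toReal).ennreal_ofReal

section Envelope

variable {d : ℕ} {S : Type*} {G : (Fin d → ℂ) → S → ℂ}

theorem envelope_nonneg (K : Set (Fin d → ℂ)) (x : S) : 0 ≤ envelope G K x :=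
  Real.sSup_nonneg (by rintro _ ⟨z, _, rfl⟩; exact norm_nonneg _)

theorem norm_le_envelope (hholo : ∀ x, Differentiable ℂ (fun z => G z x))
    {K : Set (Fin d → ℂ)} (hK : IsCompact K) {z : Fin d → ℂ} (hz : z ∈ K) (x : S) :
    ‖G z x‖ ≤ envelope G K x :=
  le_csSup (hK.image (hholo x).continuous.norm).bddAbove ⟨z, hz, rfl⟩

theorem envelope_mono (hholo : ∀ x, Differentiable ℂ (fun z => G z x))
    {K K' : Set (Fin d → ℂ)} (hK' : IsCompact K') (h : K ⊆ K') (x : S) :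
    envelope G K x ≤ envelope G K' x :=
  Real.sSup_le (by rintro _ ⟨z, hz, rfl⟩; exact norm_le_envelope hholo hK' (h hz) x)
    (envelope_nonneg _ _)

variable [MeasurableSpace S]

theorem integrable_envelope {K : Set (Fin d → ℂ)} (henv : Measurable (envelope G K))
    {η : Measure S} (hη : ∫⁻ x, ENNReal.ofReal (envelope G K x) ∂η < ⊤) :
    Integrable (envelope G K) η :=
  (lintegral_ofReal_ne_top_iff_integrable henv.aestronglyMeasurable
    (ae_of_all _ (envelope_nonneg K))).1 hη.ne

theorem ae_forall_lintegral_envelope_lt_top (hholo : ∀ x, Differentiable ℂ (fun z => G z x))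
    (henv : ∀ K : Set (Fin d → ℂ), IsCompact K → Measurable (envelope G K))
    {μ : Measure (Measure S)}
    (hexp : ∀ K : Set (Fin d → ℂ), IsCompact K →
      ∫⁻ η, expE (∫⁻ x, ENNReal.ofReal (envelope G K x) ∂η) ∂μ < ⊤) :
    ∀ᵐ η ∂μ, ∀ K : Set (Fin d → ℂ), IsCompact K →
      ∫⁻ x, ENNReal.ofReal (envelope G K x) ∂η < ⊤ := by
  have hball : ∀ᵐ η ∂μ, ∀ k : ℕ,
      ∫⁻ x, ENNReal.ofReal (envelope G (closedBall 0 k) x) ∂η < ⊤ := by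
    refine ae_all_iff.2 fun k => ?_
    have hK := isCompact_closedBall (0 : Fin d → ℂ) k
    filter_upwards [ae_lt_top (measurable_expE.comp
      (Measure.measurable_lintegral (henv _ hK).ennreal_ofReal)) (hexp _ hK).ne] with η hη
    refine lt_top_iff_ne_top.2 fun h => ?_
    simp [expE, h] at hη
  filter_upwards [hball] with η hη K hK
  obtain ⟨R, hR⟩ := hK.isBounded.subset_closedBall 0
  obtain ⟨k, hk⟩ := exists_nat_ge R
  exact (lintegral_mono fun x => ENNReal.ofReal_le_ofReal (envelope_mono hholo
    (isCompact_closedBall 0 _) (hR.trans (closedBall_subset_closedBall hk)) x)).trans_lt (hη k)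

/-- Finiteness of the exponential moment of `∫ g_K dη` gives all its polynomial moments. -/
theorem integrable_integral_envelope_pow {K : Set (Fin d → ℂ)}
    (henv : Measurable (envelope G K)) {μ : Measure (Measure S)}
    (hfin : ∀ᵐ η ∂μ, ∫⁻ x, ENNReal.ofReal (envelope G K x) ∂η < ⊤)
    (hexp : ∫⁻ η, expE (∫⁻ x, ENNReal.ofReal (envelope G K x) ∂η) ∂μ < ⊤) (n : ℕ) :
    Integrable (fun η : Measure S => (∫ x, envelope G K x ∂η) ^ n) μ := by
  have hA (η : Measure S) : ∫ x, envelope G K x ∂η =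
      (∫⁻ x, ENNReal.ofReal (envelope G K x) ∂η).toReal :=
    integral_eq_lintegral_of_nonneg_ae (ae_of_all _ (envelope_nonneg K))
      henv.aestronglyMeasurable
  have hmeas := Measure.measurable_lintegral henv.ennreal_ofReal
  simp only [hA]
  refine ((integrable_toReal_of_lintegral_ne_top (measurable_expE.comp hmeas).aemeasurable
    hexp.ne).const_mul (n.factorial : ℝ)).mono'
    (hmeas.ennreal_toReal.pow_const n).aestronglyMeasurable ?_
  filter_upwards [hfin] with η hη
  rw [Real.norm_of_nonneg (by positivity)]
  simp only [Function.comp_apply, expE, if_neg hη.ne, ENNReal.toReal_ofReal (Real.exp_nonneg _)]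
  rw [mul_comm, ← div_le_iff₀ (by positivity)]
  exact Real.pow_div_factorial_le_exp _ ENNReal.toReal_nonneg n

theorem integrable_kernel (hmeas : ∀ z, Measurable (fun x => G z x))
    (hholo : ∀ x, Differentiable ℂ (fun z => G z x))
    (henv : ∀ K : Set (Fin d → ℂ), IsCompact K → Measurable (envelope G K)) {η : Measure S}
    (hη : ∀ K : Set (Fin d → ℂ), IsCompact K →
      ∫⁻ x, ENNReal.ofReal (envelope G K x) ∂η < ⊤) (z : Fin d → ℂ) :
    Integrable (G z) η :=
  (integrable_envelope (henv {z} isCompact_singleton) (hη {z} isCompact_singleton)).mono'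
    (hmeas z).aestronglyMeasurable
    (ae_of_all _ (norm_le_envelope hholo isCompact_singleton rfl))

theorem norm_integral_kernel_le (hholo : ∀ x, Differentiable ℂ (fun z => G z x))
    {K : Set (Fin d → ℂ)} (hK : IsCompact K) (henv : Measurable (envelope G K))
    {η : Measure S} (hη : ∫⁻ x, ENNReal.ofReal (envelope G K x) ∂η < ⊤)
    {z : Fin d → ℂ} (hz : z ∈ K) :
    ‖∫ x, G z x ∂η‖ ≤ ∫ x, envelope G K x ∂η :=
  norm_integral_le_of_norm_le (integrable_envelope henv hη)
    (ae_of_all _ (norm_le_envelope hholo hK hz))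

/-- The convoluted field `z ↦ ∫ G(z, x) dη(x)` is holomorphic. -/
theorem differentiable_integral_kernel (hmeas : ∀ z, Measurable (fun x => G z x))
    (hholo : ∀ x, Differentiable ℂ (fun z => G z x))
    (henv : ∀ K : Set (Fin d → ℂ), IsCompact K → Measurable (envelope G K)) {η : Measure S}
    (hη : ∀ K : Set (Fin d → ℂ), IsCompact K →
      ∫⁻ x, ENNReal.ofReal (envelope G K x) ∂η < ⊤) :
    Differentiable ℂ (fun z => ∫ x, G z x ∂η) :=
  differentiable_integral_of_locally_dominated (fun z => (hmeas z).aestronglyMeasurable)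
    (ae_of_all _ hholo) fun z₀ => ⟨1, one_pos, envelope G (closedBall z₀ 1),
      integrable_envelope (henv _ (isCompact_closedBall _ _)) (hη _ (isCompact_closedBall _ _)),
      ae_of_all _ fun x _ hz => norm_le_envelope hholo (isCompact_closedBall _ _)
        (ball_subset_closedBall hz) x⟩

end Envelope

/-- Theorem 6.2: the analytically continued Schwinger functions
`S_n^c(z₁, …, z_n) = ∫ ∏_j (G^c * η)(z_j) dμ(η)` are well-defined and
holomorphic on `(ℂ^d)^n`. -/
theorem schwinger_holomorphic {d : ℕ} {S : Type*} [MeasurableSpace S]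
    (G : (Fin d → ℂ) → S → ℂ)
    (hmeas : ∀ z, Measurable (fun x => G z x))
    (hholo : ∀ x, Differentiable ℂ (fun z => G z x))
    (henv : ∀ K : Set (Fin d → ℂ), IsCompact K → Measurable (envelope G K))
    (μ : Measure (Measure S)) [IsProbabilityMeasure μ]
    (hexp : ∀ K : Set (Fin d → ℂ), IsCompact K →
      ∫⁻ η, expE (∫⁻ x, ENNReal.ofReal (envelope G K x) ∂η) ∂μ < ⊤)
    (n : ℕ) :
    (∀ᵐ η ∂μ, ∀ K : Set (Fin d → ℂ), IsCompact K →
      ∫⁻ x, ENNReal.ofReal (envelope G K x) ∂η < ⊤) ∧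
    (∀ z : Fin n → (Fin d → ℂ),
      Integrable (fun η : Measure S => ∏ j, ∫ x, G (z j) x ∂η) μ) ∧
    Differentiable ℂ
      (fun z : Fin n → (Fin d → ℂ) => ∫ η, ∏ j, ∫ x, G (z j) x ∂η ∂μ) := by
  have hfin := ae_forall_lintegral_envelope_lt_top hholo henv hexp
  have haesm (z : Fin n → Fin d → ℂ) :
      AEStronglyMeasurable (fun η : Measure S => ∏ j, ∫ x, G (z j) x ∂η) μ := by
    refine AEMeasurable.aestronglyMeasurable
      (Finset.aemeasurable_fun_prod _ fun j _ => ?_)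
    refine aemeasurable_integral_random_measure (hmeas (z j)) ?_
    filter_upwards [hfin] with η hη using integrable_kernel hmeas hholo henv hη (z j)
  have hdom (z₀ : Fin n → Fin d → ℂ) : ∃ r > 0, ∃ g : Measure S → ℝ, Integrable g μ ∧
      ∀ᵐ η ∂μ, ∀ z ∈ ball z₀ r, ‖∏ j, ∫ x, G (z j) x ∂η‖ ≤ g η := by
    have hK := isCompact_closedBall (0 : Fin d → ℂ) (‖z₀‖ + 1)
    refine ⟨1, one_pos, _, integrable_integral_envelope_pow (henv _ hK)
      (hfin.mono fun η hη => hη _ hK) (hexp _ hK) n, ?_⟩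
    filter_upwards [hfin] with η hη z hz
    have hz' : ‖z‖ ≤ ‖z₀‖ + 1 := by
      have h₁ := norm_le_norm_add_norm_sub z₀ z
      have h₂ := mem_ball_iff_norm'.1 hz
      linarith
    rw [norm_prod]
    refine (Finset.prod_le_prod (fun _ _ => norm_nonneg _) fun j _ =>
      norm_integral_kernel_le hholo hK (henv _ hK) (hη _ hK)
        (mem_closedBall_zero_iff.2 ((norm_le_pi_norm z j).trans hz'))).trans_eq ?_
    simp
  refine ⟨hfin, fun z => ?_, differentiable_integral_of_locally_dominated haesm ?_ hdom⟩
  · obtain ⟨r, hr, g, hg, hle⟩ := hdom z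
    exact hg.mono' (haesm z) (hle.mono fun η h => h z (mem_ball_self hr))
  · filter_upwards [hfin] with η hη
    intro z
    have hj (j : Fin n) : DifferentiableAt ℂ
        (fun z : Fin n → Fin d → ℂ => ∫ x, G (z j) x ∂η) z :=
      ((differentiable_integral_kernel hmeas hholo henv hη).comp (differentiable_apply j)) z
    exact (HasFDerivAt.finsetProd fun j _ => (hj j).hasFDerivAt).differentiableAt
end

section
/- Let F : (ℂ^d)ⁿ → ℂ be holomorphic on all of (ℂ^d)ⁿ and invariant under simultaneous real translations, i.e. F(z₁ + ã, …, z_n + ã) = F(z₁, …, z_n) for all a ∈ ℝ^d and all (z₁,…,z_n) ∈ (ℂ^d)ⁿ, where ã ∈ ℂ^d denotes a with coordinates regarded as complex numbers. Then F is invariant under all simultaneous complex translations: F(z₁ + w, …, z_n + w) = F(z₁, …, z_n) for all w ∈ ℂ^d and all (z₁,…,z_n) ∈ (ℂ^d)ⁿ. (This is the instance of Theorem 2.6 for the translation group used in the proof of Theorem 6.3.) -/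
open Filter Topology in
/-- An entire function of one variable that is constant on the real line is constant. -/
theorem Differentiable.eq_const_of_forall_real {g : ℂ → ℂ} (hg : Differentiable ℂ g) {c : ℂ}
    (hc : ∀ t : ℝ, g t = c) (s : ℂ) : g s = c := by
  have hfreq : ∃ᶠ t in 𝓝[≠] (0 : ℂ), g t = c := by
    have htend : Tendsto (fun t : ℝ => (t : ℂ)) (𝓝[≠] 0) (𝓝[≠] 0) := by
      refine tendsto_nhdsWithin_iff.2 ⟨?_, ?_⟩
      · exact (Complex.continuous_ofReal.tendsto' 0 0 Complex.ofReal_zero).mono_left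
          nhdsWithin_le_nhds
      · filter_upwards [self_mem_nhdsWithin] with t ht
        simpa using ht
    exact htend.frequently (Eventually.of_forall hc).frequently
  have hconst : g = fun _ => c := AnalyticOnNhd.eq_of_frequently_eq
    (fun x _ => hg.analyticAt x) (fun _ _ => analyticAt_const) hfreq
  exact congrFun hconst s

/-- Instance of Theorem 2.6 for the translation group: an entire function on
`(ℂ^d)^n` invariant under simultaneous real translations is invariant under
all simultaneous complex translations. -/
theorem real_translation_invariance_extends {d n : ℕ}
    (F : (Fin n → (Fin d → ℂ)) → ℂ) (hF : Differentiable ℂ F)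
    (hinv : ∀ (a : Fin d → ℝ) (z : Fin n → (Fin d → ℂ)),
      F (fun j => z j + fun i => (a i : ℂ)) = F z) :
    ∀ (w : Fin d → ℂ) (z : Fin n → (Fin d → ℂ)),
      F (fun j => z j + w) = F z := by
  intro w z
  -- Restrict `F` to the complex line through `z + Re w` in the direction `Im w`.
  let L : ℂ → Fin n → Fin d → ℂ := fun t j i => z j i + ((w i).re + t * (w i).im)
  have hL : Differentiable ℂ L := by
    refine differentiable_pi.2 fun j => differentiable_pi.2 fun i => ?_
    fun_prop
  have hreal (t : ℝ) : F (L t) = F z := by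
    rw [← hinv (fun i => (w i).re + t * (w i).im) z]
    congr 1
    ext j i
    simp [L]
  rw [← (hF.comp hL).eq_const_of_forall_real hreal Complex.I]
  simp only [Function.comp_apply]
  congr 1
  ext j i
  simp only [L, Pi.add_apply, mul_comm Complex.I, Complex.re_add_im]
end

section
/- Fix ε > 0, let f : ℝ^d → [0,∞) be Lebesgue integrable, and define F : ℂ^d → ℂ by F(z) = ∫_{ℝ^d} exp(−(∑_{j=1}^d (z_j − x_j)²)/(2ε)) f(x) dx. Then for every compact K ⊆ ℂ^d the envelope g_K : ℝ^d → [0,∞), g_K(x) = sup_{z∈K} |F(z − x̃)| (where x̃ ∈ ℂ^d is x with coordinates regarded as complex numbers), is finite everywhere, bounded, continuous, and Lebesgue integrable over ℝ^d. (This is property (II) of Lemma 6.1 for the mollified kernel: g_K ∈ L¹(ℝ^d) ∩ C_b(ℝ^d).) -/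
open MeasureTheory

/-- The entire extension of the mollified kernel: the convolution of the entire
Gaussian extension `g_ε^c` with an integrable function `f` on `ℝ^d`
(up to the normalization constant `(2πε)^{-d/2}`). -/
noncomputable def Fc {d : ℕ} (ε : ℝ) (f : (Fin d → ℝ) → ℝ) (z : Fin d → ℂ) : ℂ :=
  ∫ x : Fin d → ℝ,
    Complex.exp (-(∑ j, (z j - (x j : ℂ)) ^ 2) / (2 * (ε : ℂ))) * (f x : ℂ)

/-- The translation envelope `g_K(x) = sup_{z ∈ K} |F(z - x̃)|`. -/
noncomputable def transEnvelope {d : ℕ} (F : (Fin d → ℂ) → ℂ)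
    (K : Set (Fin d → ℂ)) (x : Fin d → ℝ) : ℝ :=
  sSup ((fun z => ‖F (z - fun i => (x i : ℂ))‖) '' K)

/-- The Gaussian of variance `2ε` on `ℝ^d`, normalized to have value `1` at the origin. -/
noncomputable def widenedGaussian {d : ℕ} (ε : ℝ) (t : Fin d → ℝ) : ℝ :=
  ∏ j, Real.exp (-(4 * ε)⁻¹ * t j ^ 2)

lemma widenedGaussian_nonneg {d : ℕ} (ε : ℝ) (t : Fin d → ℝ) : 0 ≤ widenedGaussian ε t :=
  Finset.prod_nonneg fun _ _ => (Real.exp_pos _).le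

lemma widenedGaussian_le_one {d : ℕ} {ε : ℝ} (hε : 0 < ε) (t : Fin d → ℝ) :
    widenedGaussian ε t ≤ 1 := by
  refine Finset.prod_le_one (fun _ _ => (Real.exp_pos _).le) fun j _ => ?_
  rw [Real.exp_le_one_iff, neg_mul, neg_nonpos]
  positivity

lemma widenedGaussian_neg {d : ℕ} (ε : ℝ) (t : Fin d → ℝ) :
    widenedGaussian ε (-t) = widenedGaussian ε t := by
  simp [widenedGaussian]

lemma continuous_widenedGaussian {d : ℕ} (ε : ℝ) :
    Continuous (widenedGaussian (d := d) ε) := by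
  unfold widenedGaussian
  fun_prop

lemma integrable_widenedGaussian {d : ℕ} {ε : ℝ} (hε : 0 < ε) :
    Integrable (widenedGaussian (d := d) ε) :=
  Integrable.fintype_prod (f := fun _ : Fin d => fun s : ℝ => Real.exp (-(4 * ε)⁻¹ * s ^ 2))
    fun _ => integrable_exp_neg_mul_sq (by positivity)

/-- On a bounded set of complex shifts, the Gaussian kernel is dominated by a fixed multiple of
a wider real Gaussian. -/
lemma norm_gaussian_kernel_le {d : ℕ} {ε : ℝ} (hε : 0 < ε) {R : ℝ} {z : Fin d → ℂ}
    (hz : ‖z‖ ≤ R) (x y : Fin d → ℝ) :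
    ‖Complex.exp (-(∑ j, ((z - fun i => (x i : ℂ)) j - (y j : ℂ)) ^ 2) / (2 * (ε : ℂ)))‖ ≤
      Real.exp (d * (R ^ 2 / (2 * ε))) * widenedGaussian ε (x + y) := by
  have hcoord : ∀ j, (z j).re ^ 2 + (z j).im ^ 2 ≤ R ^ 2 := fun j => by
    have h : ‖z j‖ ≤ R := (norm_le_pi_norm z j).trans hz
    have h2 := Complex.sq_norm (z j)
    rw [Complex.normSq_apply] at h2
    nlinarith [norm_nonneg (z j)]
  have hconst : (d : ℝ) * (R ^ 2 / (2 * ε)) = ∑ _j : Fin d, R ^ 2 / (2 * ε) := by simp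
  rw [Complex.norm_exp, widenedGaussian, ← Real.exp_sum, ← Real.exp_add, Real.exp_le_exp, hconst,
    ← Finset.sum_add_distrib]
  have hre : (-(∑ j, ((z - fun i => (x i : ℂ)) j - (y j : ℂ)) ^ 2) / (2 * (ε : ℂ))).re =
      ∑ j, -(((z j).re - x j - y j) ^ 2 - (z j).im ^ 2) / (2 * ε) := by
    have hcast : (2 * (ε : ℂ)) = ((2 * ε : ℝ) : ℂ) := by push_cast; rfl
    rw [hcast, Complex.div_ofReal_re, Complex.neg_re, Complex.re_sum, ← Finset.sum_neg_distrib,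
      Finset.sum_div]
    refine Finset.sum_congr rfl fun j _ => ?_
    simp [sq]
  rw [hre]
  refine Finset.sum_le_sum fun j _ => ?_
  have hrhs : R ^ 2 / (2 * ε) + -(4 * ε)⁻¹ * (x + y) j ^ 2 =
      (R ^ 2 - (x j + y j) ^ 2 / 2) / (2 * ε) := by
    simp only [Pi.add_apply]
    field_simp
    ring
  rw [hrhs]
  gcongr
  nlinarith [hcoord j, sq_nonneg (2 * (z j).re - (x j + y j))]

lemma continuous_Fc {d : ℕ} {ε : ℝ} (hε : 0 < ε) {f : (Fin d → ℝ) → ℝ} (hfint : Integrable f) :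
    Continuous (Fc ε f) := by
  refine continuous_iff_continuousAt.2 fun z₀ => ?_
  refine continuousAt_of_dominated
    (bound := fun y => Real.exp (d * ((‖z₀‖ + 1) ^ 2 / (2 * ε))) * ‖f y‖) ?_ ?_
    (hfint.norm.const_mul _) ?_
  · refine Filter.Eventually.of_forall fun z => ?_
    refine AEStronglyMeasurable.mul ?_
      (Complex.continuous_ofReal.comp_aestronglyMeasurable hfint.aestronglyMeasurable)
    exact Continuous.aestronglyMeasurable (by fun_prop)
  · filter_upwards [Metric.ball_mem_nhds z₀ one_pos] with z hz
    refine Filter.Eventually.of_forall fun y => ?_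
    have hzR : ‖z‖ ≤ ‖z₀‖ + 1 := by
      have h1 := norm_le_norm_add_norm_sub' z z₀
      have h2 := mem_ball_iff_norm.1 hz
      linarith
    have h := norm_gaussian_kernel_le hε hzR 0 y
    simp only [Pi.sub_apply, Pi.zero_apply, Complex.ofReal_zero, sub_zero, zero_add] at h
    rw [norm_mul, Complex.norm_real]
    refine mul_le_mul_of_nonneg_right (h.trans ?_) (norm_nonneg _)
    exact mul_le_of_le_one_right (Real.exp_pos _).le (widenedGaussian_le_one hε y)
  · exact Filter.Eventually.of_forall fun y => Continuous.continuousAt (by fun_prop)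

lemma integrable_widenedGaussian_mul {d : ℕ} {ε : ℝ} (hε : 0 < ε) {f : (Fin d → ℝ) → ℝ}
    (hfint : Integrable f) (x : Fin d → ℝ) :
    Integrable fun y => widenedGaussian ε (x + y) * f y := by
  refine hfint.bdd_mul (c := 1) ?_ (Filter.Eventually.of_forall fun y => ?_)
  · exact ((continuous_widenedGaussian ε).comp (by fun_prop)).aestronglyMeasurable
  · rw [Real.norm_of_nonneg (widenedGaussian_nonneg ε _)]
    exact widenedGaussian_le_one hε _

lemma norm_Fc_sub_le {d : ℕ} {ε : ℝ} (hε : 0 < ε) {f : (Fin d → ℝ) → ℝ} (hf0 : ∀ x, 0 ≤ f x)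
    (hfint : Integrable f) {R : ℝ} {z : Fin d → ℂ} (hz : ‖z‖ ≤ R) (x : Fin d → ℝ) :
    ‖Fc ε f (z - fun i => (x i : ℂ))‖ ≤
      Real.exp (d * (R ^ 2 / (2 * ε))) * ∫ y, widenedGaussian ε (x + y) * f y := by
  rw [← integral_const_mul]
  refine norm_integral_le_of_norm_le ((integrable_widenedGaussian_mul hε hfint x).const_mul _)
    (Filter.Eventually.of_forall fun y => ?_)
  rw [norm_mul, Complex.norm_real, Real.norm_of_nonneg (hf0 y), ← mul_assoc]
  exact mul_le_mul_of_nonneg_right (norm_gaussian_kernel_le hε hz x y) (hf0 y)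

lemma integrable_integral_widenedGaussian_mul {d : ℕ} {ε : ℝ} (hε : 0 < ε)
    {f : (Fin d → ℝ) → ℝ} (hfint : Integrable f) :
    Integrable fun x : Fin d → ℝ => ∫ y, widenedGaussian ε (x + y) * f y := by
  have h := (hfint.integrable_convolution (ContinuousLinearMap.mul ℝ ℝ)
    (integrable_widenedGaussian hε)).comp_neg
  refine h.congr (Filter.Eventually.of_forall fun x => ?_)
  simp only [convolution, ContinuousLinearMap.mul_apply']
  refine integral_congr_ae (Filter.Eventually.of_forall fun y => ?_)
  have hxy : -x - y = -(x + y) := by abel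
  simp only [hxy, widenedGaussian_neg, mul_comm]

lemma transEnvelope_nonneg {d : ℕ} (F : (Fin d → ℂ) → ℂ) (K : Set (Fin d → ℂ))
    (x : Fin d → ℝ) : 0 ≤ transEnvelope F K x := by
  refine Real.sSup_nonneg ?_
  rintro _ ⟨z, -, rfl⟩
  exact norm_nonneg _

lemma continuous_norm_comp_sub {d : ℕ} {F : (Fin d → ℂ) → ℂ} (hF : Continuous F) :
    Continuous fun p : (Fin d → ℝ) × (Fin d → ℂ) => ‖F (p.2 - fun i => (p.1 i : ℂ))‖ :=
  (hF.comp (by fun_prop)).norm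

lemma continuous_transEnvelope {d : ℕ} {F : (Fin d → ℂ) → ℂ} (hF : Continuous F)
    {K : Set (Fin d → ℂ)} (hK : IsCompact K) : Continuous (transEnvelope F K) :=
  hK.continuous_sSup (f := fun (x : Fin d → ℝ) (z : Fin d → ℂ) => ‖F (z - fun i => (x i : ℂ))‖)
    (continuous_norm_comp_sub hF)

lemma bddAbove_norm_comp_sub_image {d : ℕ} {F : (Fin d → ℂ) → ℂ} (hF : Continuous F)
    {K : Set (Fin d → ℂ)} (hK : IsCompact K) (x : Fin d → ℝ) :
    BddAbove ((fun z => ‖F (z - fun i => (x i : ℂ))‖) '' K) :=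
  hK.bddAbove_image
    ((continuous_norm_comp_sub hF).comp (Continuous.prodMk_right x)).continuousOn

lemma transEnvelope_Fc_le {d : ℕ} {ε : ℝ} (hε : 0 < ε) {f : (Fin d → ℝ) → ℝ}
    (hf0 : ∀ x, 0 ≤ f x) (hfint : Integrable f) {R : ℝ} {K : Set (Fin d → ℂ)}
    (hR : ∀ z ∈ K, ‖z‖ ≤ R) (x : Fin d → ℝ) :
    transEnvelope (Fc ε f) K x ≤
      Real.exp (d * (R ^ 2 / (2 * ε))) * ∫ y, widenedGaussian ε (x + y) * f y := by
  have hnonneg : 0 ≤ ∫ y, widenedGaussian ε (x + y) * f y :=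
    integral_nonneg fun y => mul_nonneg (widenedGaussian_nonneg ε _) (hf0 y)
  refine Real.sSup_le ?_ (mul_nonneg (Real.exp_pos _).le hnonneg)
  rintro _ ⟨z, hz, rfl⟩
  exact norm_Fc_sub_le hε hf0 hfint (hR z hz) x

/-- Property (II) of Lemma 6.1 for the mollified kernel: for every compact
`K ⊆ ℂ^d`, the envelope `g_K(x) = sup_{z ∈ K} |F(z - x̃)|` is finite
everywhere, nonnegative, bounded, continuous, and Lebesgue integrable. -/
theorem mollified_kernel_envelope {d : ℕ} (ε : ℝ) (hε : 0 < ε)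
    (f : (Fin d → ℝ) → ℝ) (hf0 : ∀ x, 0 ≤ f x) (hfint : Integrable f) :
    ∀ K : Set (Fin d → ℂ), IsCompact K →
      (∀ x : Fin d → ℝ,
        BddAbove ((fun z => ‖Fc ε f (z - fun i => (x i : ℂ))‖) '' K)) ∧
      (∀ x, 0 ≤ transEnvelope (Fc ε f) K x) ∧
      (∃ M : ℝ, ∀ x, transEnvelope (Fc ε f) K x ≤ M) ∧
      Continuous (transEnvelope (Fc ε f) K) ∧
      Integrable (transEnvelope (Fc ε f) K) := by
  intro K hK
  obtain ⟨R, hR⟩ := hK.isBounded.exists_norm_le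
  have hF : Continuous (Fc ε f) := continuous_Fc hε hfint
  have henv := continuous_transEnvelope hF hK
  have hle := transEnvelope_Fc_le hε hf0 hfint hR
  refine ⟨bddAbove_norm_comp_sub_image hF hK, transEnvelope_nonneg _ K,
    ⟨Real.exp (d * (R ^ 2 / (2 * ε))) * ∫ y, f y, fun x => ?_⟩, henv, ?_⟩
  · refine (hle x).trans (mul_le_mul_of_nonneg_left ?_ (Real.exp_pos _).le)
    refine integral_mono (integrable_widenedGaussian_mul hε hfint x) hfint fun y => ?_
    exact mul_le_of_le_one_left (hf0 y) (widenedGaussian_le_one hε _)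
  · refine ((integrable_integral_widenedGaussian_mul hε hfint).const_mul
      (Real.exp (d * (R ^ 2 / (2 * ε))))).mono' henv.aestronglyMeasurable
      (Filter.Eventually.of_forall fun x => ?_)
    rw [Real.norm_of_nonneg (transEnvelope_nonneg _ K x)]
    exact hle x
end
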